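/- arXiv:1207.3161 — 4 statements merged into one kernel-verified Lean document; each statement's English description precedes it below -/
import Mathlib

section
/- Let f : ℂⁿ → ℂ be a mixed polynomial, V(f) = f⁻¹(0), and φ = f/|f| : ℂⁿ \ V(f) → S¹. For z ∈ ℂⁿ \ V(f), the restriction of the real differential of φ at z to the real tangent space {v ∈ ℂⁿ : Re⟨v, z⟩ = 0} of the sphere of radius ‖z‖ through z fails to be surjective onto the tangent line of S¹ at φ(z) if and only if there exists λ ∈ ℝ such that λ z = i·conj(f(z))·d̄f(z) − i·f(z)·conj(df(z)). -/
open Complex Finset Filter Topology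

/-- Coefficients of a mixed polynomial in `n` variables: a finitely supported
function assigning to each pair of multi-indices `(ν, μ)` the coefficient `c_{ν,μ}`. -/
abbrev MixedCoeff (n : ℕ) := ((Fin n → ℕ) × (Fin n → ℕ)) →₀ ℂ

/-- Evaluation of the mixed polynomial `f(z, z̄) = Σ c_{ν,μ} z^ν z̄^μ`. -/
noncomputable def mixedEval {n : ℕ} (c : MixedCoeff n) (z : Fin n → ℂ) : ℂ :=
  c.sum fun p a => a * (∏ j, z j ^ p.1 j) * ∏ j, (starRingEnd ℂ) (z j) ^ p.2 j

/-- Wirtinger derivative `∂f/∂z_j`. -/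
noncomputable def wdz {n : ℕ} (c : MixedCoeff n) (j : Fin n) (z : Fin n → ℂ) : ℂ :=
  c.sum fun p a => a * (p.1 j : ℂ) * z j ^ (p.1 j - 1) *
    (∏ k ∈ Finset.univ.erase j, z k ^ p.1 k) * ∏ k, (starRingEnd ℂ) (z k) ^ p.2 k

/-- Wirtinger derivative `∂f/∂z̄_j`. -/
noncomputable def wdzbar {n : ℕ} (c : MixedCoeff n) (j : Fin n) (z : Fin n → ℂ) : ℂ :=
  c.sum fun p a => a * (p.2 j : ℂ) * (starRingEnd ℂ) (z j) ^ (p.2 j - 1) *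
    (∏ k ∈ Finset.univ.erase j, (starRingEnd ℂ) (z k) ^ p.2 k) * ∏ k, z k ^ p.1 k

/-- The point `ν + μ ∈ ℝⁿ` associated to a monomial `z^ν z̄^μ`. -/
def exptPt {n : ℕ} (p : (Fin n → ℕ) × (Fin n → ℕ)) : Fin n → ℝ := fun j => (p.1 j + p.2 j : ℕ)

/-- `supp(f) ⊆ ℝⁿ`. -/
def mixedSupp {n : ℕ} (c : MixedCoeff n) : Set (Fin n → ℝ) :=
  {x | ∃ p ∈ c.support, exptPt p = x}

/-- The Newton polyhedron `Γ₀(f)`: convex hull of `{0} ∪ supp(f)`. -/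
noncomputable def Gamma0 {n : ℕ} (c : MixedCoeff n) : Set (Fin n → ℝ) :=
  convexHull ℝ (insert 0 (mixedSupp c))

/-- `supp̄(f)`: convex hull of `supp(f) \ {0}`. -/
noncomputable def suppBar {n : ℕ} (c : MixedCoeff n) : Set (Fin n → ℝ) :=
  convexHull ℝ (mixedSupp c \ {0})

/-- A face (of any dimension) of the Newton boundary at infinity `Γ⁺(f)`:
a face of `Γ₀(f)` not containing the origin. -/
def IsFaceAtInfinity {n : ℕ} (c : MixedCoeff n) (Δ : Set (Fin n → ℝ)) : Prop :=
  IsExtreme ℝ (Gamma0 c) Δ ∧ (0 : Fin n → ℝ) ∉ Δ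

open Classical in
/-- The restriction `f_Δ` of `f` to a face `Δ`: keep the monomials with `ν + μ ∈ Δ`. -/
noncomputable def faceRestrict {n : ℕ} (c : MixedCoeff n) (Δ : Set (Fin n → ℝ)) :
    MixedCoeff n :=
  c.filter fun p => exptPt p ∈ Δ

/-- `Sing f`: the set of mixed singularities, via Oka's characterization:
`conj (df) = λ · d̄f` for some `λ` with `|λ| = 1`. -/
def mixedSing {n : ℕ} (c : MixedCoeff n) : Set (Fin n → ℂ) :=
  {z | ∃ lam : ℂ, ‖lam‖ = 1 ∧
      ∀ j, (starRingEnd ℂ) (wdz c j z) = lam * wdzbar c j z}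

/-- `(ℂ*)ⁿ`. -/
def cstarn (n : ℕ) : Set (Fin n → ℂ) := {z | ∀ j, z j ≠ 0}

/-- `f` is Newton strongly non-degenerate: `Sing f_Δ ∩ (ℂ*)ⁿ = ∅` for every
face `Δ` of `Γ⁺(f)`. -/
def StronglyNonDeg {n : ℕ} (c : MixedCoeff n) : Prop :=
  ∀ Δ : Set (Fin n → ℝ), IsFaceAtInfinity c Δ →
    mixedSing (faceRestrict c Δ) ∩ cstarn n = ∅

/-- `f` is convenient: `supp(f)` meets every coordinate axis. -/
def Convenient {n : ℕ} (c : MixedCoeff n) : Prop :=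
  ∀ j : Fin n, ∃ p ∈ c.support, 0 < p.1 j + p.2 j ∧ ∀ k, k ≠ j → p.1 k + p.2 k = 0

/-- `V(f) = f⁻¹(0)`. -/
def Vf {n : ℕ} (c : MixedCoeff n) : Set (Fin n → ℂ) := {z | mixedEval c z = 0}

/-- `φ = f / |f|` (with junk value `0` on `V(f)`). -/
noncomputable def phiMap {n : ℕ} (c : MixedCoeff n) (z : Fin n → ℂ) : ℂ :=
  mixedEval c z / (‖mixedEval c z‖ : ℝ)

/-- `Sing φ = {z ∉ V(f) : conj(f)·d̄f = f·conj(df)}`. -/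
def SingPhi {n : ℕ} (c : MixedCoeff n) : Set (Fin n → ℂ) :=
  {z | mixedEval c z ≠ 0 ∧
    ∀ j, (starRingEnd ℂ) (mixedEval c z) * wdzbar c j z
        = mixedEval c z * (starRingEnd ℂ) (wdz c j z)}

/-- The ρ-non-regular locus `M(φ)`. -/
def Mphi {n : ℕ} (c : MixedCoeff n) : Set (Fin n → ℂ) :=
  {z | mixedEval c z ≠ 0 ∧ ∃ lam : ℝ, ∀ j,
    (lam : ℂ) * z j = Complex.I * (starRingEnd ℂ) (mixedEval c z) * wdzbar c j z
      - Complex.I * mixedEval c z * (starRingEnd ℂ) (wdz c j z)}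

/-- The Milnor set `M(f)`. -/
def Mf {n : ℕ} (c : MixedCoeff n) : Set (Fin n → ℂ) :=
  {z | ∃ lam : ℝ, ∃ mu : ℂ, mu ≠ 0 ∧ ∀ j,
    (lam : ℂ) * z j = mu * (starRingEnd ℂ) (wdz c j z) + (starRingEnd ℂ) mu * wdzbar c j z}

/-- The asymptotic ρ-non-regular values `S(φ)` of `f/|f|`. -/
noncomputable def Sphi {n : ℕ} (c : MixedCoeff n) : Set ℂ :=
  {v | ∃ zk : ℕ → (Fin n → ℂ), (∀ k, zk k ∈ Mphi c) ∧
    Tendsto (fun k => ‖zk k‖) atTop atTop ∧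
    Tendsto (fun k => phiMap c (zk k)) atTop (nhds v)}

/-- The asymptotic ρ-non-regular values `S(f)`. -/
noncomputable def Sf {n : ℕ} (c : MixedCoeff n) : Set ℂ :=
  {v | ∃ zk : ℕ → (Fin n → ℂ), (∀ k, zk k ∈ Mf c) ∧
    Tendsto (fun k => ‖zk k‖) atTop atTop ∧
    Tendsto (fun k => mixedEval c (zk k)) atTop (nhds v)}

/-- `v₁(z) = |f(z)|⁻² (f·conj(df) + conj(f)·d̄f)`, the gradient of `log |f|`. -/
noncomputable def vOne {n : ℕ} (c : MixedCoeff n) (z : Fin n → ℂ) : Fin n → ℂ := fun j =>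
  ((‖mixedEval c z‖ : ℂ) ^ 2)⁻¹ *
    (mixedEval c z * (starRingEnd ℂ) (wdz c j z)
      + (starRingEnd ℂ) (mixedEval c z) * wdzbar c j z)

/-- `v₂(z) = i|f(z)|⁻² (f·conj(df) − conj(f)·d̄f)`, the gradient of the argument of `f`. -/
noncomputable def vTwo {n : ℕ} (c : MixedCoeff n) (z : Fin n → ℂ) : Fin n → ℂ := fun j =>
  Complex.I * ((‖mixedEval c z‖ : ℂ) ^ 2)⁻¹ *
    (mixedEval c z * (starRingEnd ℂ) (wdz c j z)
      - (starRingEnd ℂ) (mixedEval c z) * wdzbar c j z)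

/-- The Euclidean inner product `Re⟨a, b⟩ = Re Σ a_j conj(b_j)` on `ℂⁿ ≅ ℝ^{2n}`. -/
noncomputable def hermRe {n : ℕ} (a b : Fin n → ℂ) : ℝ :=
  (∑ j, a j * (starRingEnd ℂ) (b j)).re

/-- `w / |w| ∈ S¹` (with junk value `1` for `w = 0`). -/
noncomputable def unitArg (w : ℂ) : Metric.sphere (0 : ℂ) 1 :=
  if h : w = 0 then ⟨1, by simp⟩
  else ⟨w / (‖w‖ : ℝ), by
    have h1 : (‖w‖ : ℝ) ≠ 0 := by
      simpa using h
    simp [mem_sphere_iff_norm, div_self h1]⟩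

/-- A locally trivial fibration with fibre `F`. -/
def IsLocTrivFib {E B F : Type*} [TopologicalSpace E] [TopologicalSpace B]
    [TopologicalSpace F] (p : E → B) : Prop :=
  Continuous p ∧ ∀ b : B, ∃ U : Set B, IsOpen U ∧ b ∈ U ∧
    ∃ h : (p ⁻¹' U) ≃ₜ U × F, ∀ e : (p ⁻¹' U), ((h e).1 : B) = p (e : E)

/-- Radial weighted homogeneity of type `(q₁,…,q_n; m)`. -/
def RadialWH {n : ℕ} (c : MixedCoeff n) (q : Fin n → ℤ) (m : ℕ) : Prop :=
  Finset.univ.gcd q = 1 ∧ 0 < m ∧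
    ∀ p ∈ c.support, ∑ j, q j * (p.1 j + p.2 j : ℤ) = (m : ℤ)

/-- A bad face of `supp̄(f)`. -/
def IsBadFace {n : ℕ} (c : MixedCoeff n) (Δ : Set (Fin n → ℝ)) : Prop :=
  IsExtreme ℝ (suppBar c) Δ ∧
  ∃ a : Fin n → ℝ, (∃ i, a i < 0) ∧ (∃ j, 0 < a j) ∧
    {x : Fin n → ℝ | ∑ k, a k * x k = 0} ∩ suppBar c = Δ

/-- A strictly bad face of `supp̄(f)`. -/
def IsStrictlyBadFace {n : ℕ} (c : MixedCoeff n) (Δ : Set (Fin n → ℝ)) : Prop :=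
  IsBadFace c Δ ∧ (0 : Fin n → ℝ) ∈ affineSpan ℝ Δ

lemma mixedEval_line {n : ℕ} (c : MixedCoeff n) (z v : Fin n → ℂ) :
    HasDerivAt (fun t : ℝ => mixedEval c (z + t • v))
      (∑ j, (wdz c j z * v j + wdzbar c j z * (starRingEnd ℂ) (v j))) 0 := by
  have h1 : ∀ j, HasDerivAt (fun t : ℝ => (z + t • v) j) (v j) 0 := by
    intro j
    have := ((hasDerivAt_id (0 : ℝ)).smul_const (v j)).const_add (z j)
    simpa using this
  have h2 : ∀ j, HasDerivAt (fun t : ℝ => (starRingEnd ℂ) ((z + t • v) j))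
      ((starRingEnd ℂ) (v j)) 0 := by
    intro j
    exact (h1 j).star
  have key : ∀ p : (Fin n → ℕ) × (Fin n → ℕ), ∀ a : ℂ,
      HasDerivAt (fun t : ℝ => a * (∏ j, (z + t • v) j ^ p.1 j) *
        ∏ j, (starRingEnd ℂ) ((z + t • v) j) ^ p.2 j)
      (∑ j, ((a * (p.1 j : ℂ) * z j ^ (p.1 j - 1) *
    (∏ k ∈ Finset.univ.erase j, z k ^ p.1 k) * ∏ k, (starRingEnd ℂ) (z k) ^ p.2 k) * v j +
     (a * (p.2 j : ℂ) * (starRingEnd ℂ) (z j) ^ (p.2 j - 1) *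
    (∏ k ∈ Finset.univ.erase j, (starRingEnd ℂ) (z k) ^ p.2 k) * ∏ k, z k ^ p.1 k)
      * (starRingEnd ℂ) (v j))) 0 := by
    intro p a
    have e1 := HasDerivAt.fun_finsetProd (u := Finset.univ) (fun j _ => (h1 j).fun_pow (p.1 j))
    have e2 := HasDerivAt.fun_finsetProd (u := Finset.univ) (fun j _ => (h2 j).fun_pow (p.2 j))
    refine ((e1.const_mul a).mul e2).congr_deriv ?_
    simp only [zero_smul, add_zero, smul_eq_mul, Finset.sum_add_distrib, Finset.mul_sum,
      Finset.sum_mul]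
    congr 1 <;> refine Finset.sum_congr rfl fun j _ => ?_ <;> ring
  have := HasDerivAt.fun_sum (u := c.support) (fun p _ => key p (c p))
  refine this.congr_deriv ?_
  rw [Finset.sum_comm]
  refine Finset.sum_congr rfl fun j _ => ?_
  simp only [wdz, wdzbar, Finsupp.sum, Finset.sum_add_distrib, Finset.sum_mul]

lemma mixedEval_differentiable {n : ℕ} (c : MixedCoeff n) :
    Differentiable ℝ (mixedEval c) := by
  have h1 : ∀ j : Fin n, Differentiable ℝ (fun z : Fin n → ℂ => z j) := fun j => by fun_prop
  have h2 : ∀ j : Fin n, Differentiable ℝ (fun z : Fin n → ℂ => (starRingEnd ℂ) (z j)) :=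
    fun j => (h1 j).star
  unfold mixedEval Finsupp.sum
  refine Differentiable.fun_sum fun p _ => ?_
  refine ((differentiable_const _).mul ?_).mul ?_
  · intro z
    exact (HasFDerivAt.finsetProd (𝕜 := ℝ) (u := Finset.univ)
      (g := fun j (z : Fin n → ℂ) => z j ^ p.1 j)
      fun j _ => ((h1 j).fun_pow _ z).hasFDerivAt).differentiableAt
  · intro z
    exact (HasFDerivAt.finsetProd (𝕜 := ℝ) (u := Finset.univ)
      (g := fun j (z : Fin n → ℂ) => (starRingEnd ℂ) (z j) ^ p.2 j)
      fun j _ => ((h2 j).fun_pow _ z).hasFDerivAt).differentiableAt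

lemma hasDerivAt_unit {g : ℝ → ℂ} {D : ℂ} (hg : HasDerivAt g D 0) (h0 : g 0 ≠ 0) :
    HasDerivAt (fun t => g t / (‖g t‖ : ℝ))
      (Complex.I * (g 0 / (‖g 0‖ : ℝ)) * (((starRingEnd ℂ (g 0) * D).im / ‖g 0‖ ^ 2 : ℝ) : ℂ)) 0 := by
  have hn : ‖g 0‖ ≠ 0 := norm_ne_zero_iff.mpr h0
  have hs : ‖g 0‖ ^ 2 ≠ 0 := pow_ne_zero _ hn
  have a1 := hg.norm_sq.sqrt hs
  have a2 : HasDerivAt (fun t => ‖g t‖) ((starRingEnd ℂ (g 0) * D).re / ‖g 0‖) 0 := by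
    have : (fun t => √(‖g t‖ ^ 2)) = fun t => ‖g t‖ := by
      ext t; exact Real.sqrt_sq (norm_nonneg _)
    rw [this] at a1
    refine a1.congr_deriv ?_
    rw [Real.sqrt_sq (norm_nonneg _), Complex.inner]
    field_simp
  have hnc : ((‖g 0‖ : ℝ) : ℂ) ≠ 0 := by exact_mod_cast hn
  refine (hg.div a2.ofReal_comp hnc).congr_deriv ?_
  have hD : starRingEnd ℂ (g 0) * D = ((starRingEnd ℂ (g 0) * D).re : ℂ)
      + ((starRingEnd ℂ (g 0) * D).im : ℂ) * Complex.I := (Complex.re_add_im _).symm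
  have hm : g 0 * starRingEnd ℂ (g 0) = ((‖g 0‖ : ℝ) : ℂ) ^ 2 := Complex.mul_conj' _
  push_cast
  generalize (starRingEnd ℂ (g 0) * D).re = A at *
  generalize (starRingEnd ℂ (g 0) * D).im = B at *
  generalize ((‖g 0‖ : ℝ) : ℂ) = r at *
  field_simp
  linear_combination (-D) * hm + g 0 * hD

lemma phi_fderiv {n : ℕ} (c : MixedCoeff n) (z v : Fin n → ℂ) (hz : mixedEval c z ≠ 0) :
    fderiv ℝ (phiMap c) z v = Complex.I * phiMap c z *
      ((- hermRe v (fun j => Complex.I * (starRingEnd ℂ) (mixedEval c z) * wdzbar c j z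
          - Complex.I * mixedEval c z * (starRingEnd ℂ) (wdz c j z)) / ‖mixedEval c z‖ ^ 2 : ℝ) : ℂ) := by
  have hd : DifferentiableAt ℝ (phiMap c) z := by
    unfold phiMap
    have h := mixedEval_differentiable c z
    have hn : DifferentiableAt ℝ (fun z => ((‖mixedEval c z‖ : ℝ) : ℂ)) z :=
      Complex.ofRealCLM.differentiableAt.comp z (h.norm ℝ hz)
    simp only [div_eq_mul_inv]
    exact h.fun_mul (hn.fun_inv (by simpa using hz))
  have h1 : HasDerivAt (fun t : ℝ => z + t • v) v 0 := by
    simpa using ((hasDerivAt_id (0 : ℝ)).smul_const v).const_add z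
  have h2 : HasFDerivAt (phiMap c) (fderiv ℝ (phiMap c) z) (z + (0 : ℝ) • v) := by
    simpa using hd.hasFDerivAt
  have h3 := h2.comp_hasDerivAt (0 : ℝ) h1
  have h4 := hasDerivAt_unit (mixedEval_line c z v) (by simpa using hz)
  have h5 := h3.unique h4
  rw [h5]
  simp only [zero_smul, add_zero]
  unfold phiMap hermRe
  congr 3
  rw [Finset.mul_sum, Complex.im_sum, Complex.re_sum, ← Finset.sum_neg_distrib]
  refine Finset.sum_congr rfl fun j _ => ?_
  simp
  ring

lemma hermRe_sub_smul {n : ℕ} (a b w : Fin n → ℂ) (l : ℝ) :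
    hermRe (fun j => a j - l * b j) w = hermRe a w - l * hermRe b w := by
  simp only [hermRe, Complex.re_sum, Finset.mul_sum, ← Finset.sum_sub_distrib]
  refine Finset.sum_congr rfl fun j _ => ?_
  simp
  ring

lemma hermRe_comm {n : ℕ} (a b : Fin n → ℂ) : hermRe a b = hermRe b a := by
  simp only [hermRe, Complex.re_sum]
  refine Finset.sum_congr rfl fun j _ => ?_
  simp
  ring

lemma hermRe_self_eq_zero {n : ℕ} (a : Fin n → ℂ) (h : hermRe a a = 0) (j : Fin n) :
    a j = 0 := by
  simp only [hermRe, Complex.re_sum, Complex.mul_conj, Complex.ofReal_re] at h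
  rw [Finset.sum_eq_zero_iff_of_nonneg (fun j _ => Complex.normSq_nonneg _)] at h
  exact Complex.normSq_eq_zero.mp (h j (Finset.mem_univ j))

theorem transversality_characterization {n : ℕ} (c : MixedCoeff n) (z : Fin n → ℂ)
    (hz : mixedEval c z ≠ 0) :
    (¬ ∀ w : ℂ, (w * (starRingEnd ℂ) (phiMap c z)).re = 0 →
        ∃ v : Fin n → ℂ, hermRe v z = 0 ∧ fderiv ℝ (phiMap c) z v = w) ↔
    ∃ lam : ℝ, ∀ j, (lam : ℂ) * z j =
        Complex.I * (starRingEnd ℂ) (mixedEval c z) * wdzbar c j z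
          - Complex.I * mixedEval c z * (starRingEnd ℂ) (wdz c j z) := by
  have hn : ‖mixedEval c z‖ ≠ 0 := norm_ne_zero_iff.mpr hz
  have hphi : phiMap c z * (starRingEnd ℂ) (phiMap c z) = 1 := by
    rw [Complex.mul_conj']
    simp [phiMap, hn]
  have hphi0 : phiMap c z ≠ 0 := fun h => by simp [h] at hphi
  have hf := fun v => phi_fderiv c z v hz
  set N : Fin n → ℂ := fun j => Complex.I * (starRingEnd ℂ) (mixedEval c z) * wdzbar c j z
          - Complex.I * mixedEval c z * (starRingEnd ℂ) (wdz c j z) with hN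
  constructor
  · intro h
    by_contra hcon
    apply h
    intro w hw
    set l : ℝ := hermRe N z / hermRe z z with hl
    set u : Fin n → ℂ := fun j => N j - l * z j with hu
    have huz : hermRe u z = 0 := by
      rw [hu, hermRe_sub_smul]
      by_cases h0 : hermRe z z = 0
      · have hz0 : ∀ j, z j = 0 := hermRe_self_eq_zero z h0
        simp [hermRe, hz0]
      · rw [hl]; field_simp; ring
    have huN : hermRe u N ≠ 0 := by
      have e : hermRe u u = hermRe u N := by
        have := hermRe_sub_smul N z u l
        rw [hermRe_comm z u, huz, hermRe_comm N u] at this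
        rw [← hu] at this
        linarith
      intro h0
      apply hcon
      refine ⟨l, fun j => ?_⟩
      have := hermRe_self_eq_zero u (e.trans h0) j
      exact (sub_eq_zero.mp this).symm
    set s : ℝ := (w * (starRingEnd ℂ) (phiMap c z)).im with hs
    have hws : w = Complex.I * phiMap c z * (s : ℂ) := by
      have : w * (starRingEnd ℂ) (phiMap c z) = s * Complex.I := by
        rw [← Complex.re_add_im (w * (starRingEnd ℂ) (phiMap c z)), hw]
        simp [hs]
      linear_combination (-w) * hphi + phiMap c z * this
    have hfu := hf u
    refine ⟨(-(s * ‖mixedEval c z‖ ^ 2 / hermRe u N)) • u, ?_, ?_⟩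
    · have := hermRe_sub_smul 0 u z (s * ‖mixedEval c z‖ ^ 2 / hermRe u N)
      rw [huz] at this
      have e0 : hermRe (0 : Fin n → ℂ) z = 0 := by simp [hermRe]
      rw [e0] at this
      simp only [mul_zero, sub_zero] at this
      rw [← this]
      congr 1
      ext j
      simp
    · rw [map_smul, hfu, hws, Complex.real_smul]
      have hc : ((hermRe u N : ℝ) : ℂ) ≠ 0 := by exact_mod_cast huN
      have hnc : ((‖mixedEval c z‖ : ℝ) : ℂ) ≠ 0 := by exact_mod_cast hn
      push_cast
      field_simp
  · rintro ⟨l, hl⟩ h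
    obtain ⟨v, hv, hvw⟩ := h (Complex.I * phiMap c z) (by rw [mul_assoc, hphi]; simp)
    have hvN : hermRe v N = 0 := by
      have e : N = fun j => (0 : Fin n → ℂ) j - ((-l : ℝ) : ℂ) * z j := by
        ext j
        simp [hl j, hN]
      rw [hermRe_comm, e, hermRe_sub_smul, hermRe_comm z v, hv]
      simp [hermRe]
    rw [hf v, hvN] at hvw
    simp [hphi0] at hvw
end

section
/- Let f : ℂⁿ → ℂ be a mixed polynomial, V(f) = f⁻¹(0), and φ = f/|f| : ℂⁿ \ V(f) → S¹. Then the set of critical points of the smooth map φ (points of ℂⁿ \ V(f) where the real differential of φ is not surjective onto the tangent line of S¹) is exactly {z ∈ ℂⁿ \ V(f) : conj(f(z))·d̄f(z) = f(z)·conj(df(z))}. -/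
open Complex Finset Filter Topology

/-- Real differential of a mixed polynomial in terms of Wirtinger derivatives. -/
lemma mixedEval_hasFDerivAt {n : ℕ} (c : MixedCoeff n) (z : Fin n → ℂ) :
    ∃ D : (Fin n → ℂ) →L[ℝ] ℂ, HasFDerivAt (mixedEval c) D z ∧
      ∀ v, D v = ∑ j, (wdz c j z * v j + wdzbar c j z * (starRingEnd ℂ) (v j)) := by
  have hz : ∀ j : Fin n, HasFDerivAt (fun x : Fin n → ℂ => x j)
      (ContinuousLinearMap.proj (R := ℝ) (φ := fun _ : Fin n => ℂ) j) z := fun j =>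
    (ContinuousLinearMap.proj (R := ℝ) (φ := fun _ : Fin n => ℂ) j).hasFDerivAt
  have hzb : ∀ j : Fin n, HasFDerivAt (fun x : Fin n → ℂ => (starRingEnd ℂ) (x j))
      ((Complex.conjCLE : ℂ →L[ℝ] ℂ).comp
        (ContinuousLinearMap.proj (R := ℝ) (φ := fun _ : Fin n => ℂ) j)) z := fun j =>
    ((Complex.conjCLE : ℂ →L[ℝ] ℂ).comp
        (ContinuousLinearMap.proj (R := ℝ) (φ := fun _ : Fin n => ℂ) j)).hasFDerivAt
  have hA : ∀ p : (Fin n → ℕ) × (Fin n → ℕ), _ := fun p =>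
    HasFDerivAt.finsetProd (u := Finset.univ) (fun j _ => (hz j).pow (p.1 j))
  have hB : ∀ p : (Fin n → ℕ) × (Fin n → ℕ), _ := fun p =>
    HasFDerivAt.finsetProd (u := Finset.univ) (fun j _ => (hzb j).pow (p.2 j))
  have hS := HasFDerivAt.fun_sum (u := c.support)
    (fun p _ => ((hA p).const_mul (c p)).mul (hB p))
  refine ⟨_, hS, fun v => ?_⟩
  simp only [wdz, wdzbar, Finsupp.sum, Finset.sum_mul, ← Finset.sum_add_distrib]
  rw [Finset.sum_comm]
  simp only [ContinuousLinearMap.sum_apply, ContinuousLinearMap.add_apply,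
    ContinuousLinearMap.smul_apply, smul_eq_mul, Finset.mul_sum, ← Finset.sum_add_distrib,
    ContinuousLinearMap.comp_apply, ContinuousLinearMap.proj_apply, nsmul_eq_mul]
  refine Finset.sum_congr rfl fun p _ => Finset.sum_congr rfl fun j _ => ?_
  simp
  ring

lemma phi_fderiv_s4 {n : ℕ} (F : (Fin n → ℂ) → ℂ) (z : Fin n → ℂ) (D : (Fin n → ℂ) →L[ℝ] ℂ)
    (hF : HasFDerivAt F D z) (h0 : F z ≠ 0) (v : Fin n → ℂ) :
    fderiv ℝ (fun x => F x / ((‖F x‖ : ℝ) : ℂ)) z v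
      = Complex.I * (F z / ((‖F z‖ : ℝ) : ℂ)) *
        (((D v * (starRingEnd ℂ) (F z)).im / ‖F z‖ ^ 2 : ℝ) : ℂ) := by
  have hN0 : ‖F z‖ ≠ 0 := by simpa using h0
  have hNd : DifferentiableAt ℝ (fun x => ‖F x‖) z := hF.differentiableAt.norm ℂ h0
  have hN := hNd.hasFDerivAt
  set N' := fderiv ℝ (fun x => ‖F x‖) z
  have h1 := hF.norm_sq
  have h2 := h1.unique (hN.pow 2)
  have h3 := congrArg (fun L => L v) h2
  simp [Complex.inner] at h3
  have hNC : HasFDerivAt (fun x => ((‖F x‖ : ℝ) : ℂ)) (Complex.ofRealCLM.comp N') z :=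
    Complex.ofRealCLM.hasFDerivAt.comp z hN
  have hNz : ((‖F z‖ : ℝ) : ℂ) ≠ 0 := by exact_mod_cast hN0
  have hd : DifferentiableAt ℝ (fun x => F x / ((‖F x‖ : ℝ) : ℂ)) z := by
    simp only [div_eq_mul_inv]
    exact hF.differentiableAt.mul (hNC.differentiableAt.inv hNz)
  have hm := hd.hasFDerivAt.mul hNC
  have he : ((fun x => F x / ((‖F x‖ : ℝ) : ℂ)) * fun x => ((‖F x‖ : ℝ) : ℂ)) = F := by
    funext x
    by_cases hx : F x = 0
    · simp [hx]
    · have : ((‖F x‖ : ℝ) : ℂ) ≠ 0 := by simpa using hx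
      simp [div_mul_cancel₀ _ this]
  rw [he] at hm
  have h4 := congrArg (fun L => L v) (hF.unique hm)
  simp at h4
  generalize (fderiv ℝ (fun x => F x / ((‖F x‖ : ℝ) : ℂ)) z) v = Q at h4 ⊢
  have hsq : ((‖F z‖ : ℝ) : ℂ) ^ 2 = F z * (starRingEnd ℂ) (F z) := by
    rw [Complex.mul_conj, Complex.normSq_eq_norm_sq]
    push_cast
    rfl
  have hre : (D v * (starRingEnd ℂ) (F z)).re = ‖F z‖ * N' v := by
    simp
    linarith
  have hdec := Complex.re_add_im (D v * (starRingEnd ℂ) (F z))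
  rw [hre] at hdec
  push_cast at hdec ⊢
  generalize (((D v * (starRingEnd ℂ) (F z)).im : ℝ) : ℂ) = m at hdec ⊢
  generalize ((‖F z‖ : ℝ) : ℂ) = N at *
  field_simp at h4 ⊢
  linear_combination (-N) * h4 + D v * hsq - F z * hdec

theorem singPhi_characterization {n : ℕ} (c : MixedCoeff n) :
    {z : Fin n → ℂ | mixedEval c z ≠ 0 ∧
      ¬ ∀ w : ℂ, (w * (starRingEnd ℂ) (phiMap c z)).re = 0 →
          ∃ v : Fin n → ℂ, fderiv ℝ (phiMap c) z v = w}
      = SingPhi c := by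
  ext z
  simp only [SingPhi, Set.mem_ofPred_eq]
  refine and_congr_right fun h0 => ?_
  obtain ⟨D, hD, hDv⟩ := mixedEval_hasFDerivAt c z
  have hphi : ∀ v, fderiv ℝ (phiMap c) z v = _ := phi_fderiv_s4 (mixedEval c) z D hD h0
  have hN0 : ‖mixedEval c z‖ ≠ 0 := by simpa using h0
  have hp : (phiMap c z) = mixedEval c z / ((‖mixedEval c z‖ : ℝ) : ℂ) := rfl
  rw [← hp] at hphi
  have hp1 : phiMap c z * (starRingEnd ℂ) (phiMap c z) = 1 := by
    rw [Complex.mul_conj, Complex.normSq_eq_norm_sq, hp]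
    simp [hN0]
  set φ := phiMap c z
  set f := mixedEval c z
  have hdim : ∀ v, (D v * (starRingEnd ℂ) f).im
      = ∑ j, ((wdz c j z * (starRingEnd ℂ) f - (starRingEnd ℂ) (wdzbar c j z) * f) * v j).im := by
    intro v
    rw [hDv, Finset.sum_mul, Complex.im_sum]
    refine Finset.sum_congr rfl fun j _ => ?_
    simp
    ring
  have key : (∀ v, (D v * (starRingEnd ℂ) f).im = 0) ↔
      ∀ j, (starRingEnd ℂ) f * wdzbar c j z = f * (starRingEnd ℂ) (wdz c j z) := by
    constructor
    · intro h j
      have hs : ∀ a : ℂ, ((wdz c j z * (starRingEnd ℂ) f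
          - (starRingEnd ℂ) (wdzbar c j z) * f) * a).im = 0 := by
        intro a
        have := h (Pi.single j a)
        rw [hdim, Finset.sum_eq_single j] at this
        · simpa using this
        · intro b _ hb
          simp [Pi.single_eq_of_ne hb]
        · simp
      have h1 := hs 1
      have h2 := hs Complex.I
      rw [mul_one] at h1
      rw [Complex.mul_I_im] at h2
      have h3 : wdz c j z * (starRingEnd ℂ) f - (starRingEnd ℂ) (wdzbar c j z) * f = 0 :=
        Complex.ext h2 h1
      have h4 := congrArg (starRingEnd ℂ) h3
      simp only [map_sub, map_mul, Complex.conj_conj, map_zero] at h4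
      linear_combination -h4
    · intro h v
      rw [hdim]
      refine Finset.sum_eq_zero fun j _ => ?_
      have h4 := congrArg (starRingEnd ℂ) (h j)
      simp only [map_mul, Complex.conj_conj] at h4
      have : wdz c j z * (starRingEnd ℂ) f - (starRingEnd ℂ) (wdzbar c j z) * f = 0 := by
        linear_combination -h4
      simp [this]
  rw [← key]
  constructor
  · intro h
    by_contra hc
    push Not at hc
    obtain ⟨v, hv⟩ := hc
    apply h
    intro w hw
    have hw2 : w * (starRingEnd ℂ) φ = (((w * (starRingEnd ℂ) φ).im : ℝ) : ℂ) * Complex.I := by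
      apply Complex.ext
      · simpa using hw
      · simp
    have hw3 : w = Complex.I * φ * (((w * (starRingEnd ℂ) φ).im : ℝ) : ℂ) := by
      linear_combination φ * hw2 - w * hp1
    refine ⟨((w * (starRingEnd ℂ) φ).im / ((D v * (starRingEnd ℂ) f).im / ‖f‖ ^ 2)) • v, ?_⟩
    rw [map_smul, hphi, Complex.real_smul]
    conv_rhs => rw [hw3]
    have hne : (D v * (starRingEnd ℂ) f).im / ‖f‖ ^ 2 ≠ 0 := div_ne_zero hv (pow_ne_zero _ hN0)
    generalize (D v * (starRingEnd ℂ) f).im / ‖f‖ ^ 2 = s at hne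
    have : (s : ℂ) ≠ 0 := by exact_mod_cast hne
    push_cast
    field_simp
  · intro h hsurj
    obtain ⟨v, hv⟩ := hsurj (Complex.I * φ) (by rw [mul_assoc, hp1]; simp)
    rw [hphi, h v] at hv
    have hφ : φ ≠ 0 := by
      intro h
      rw [h] at hp1
      simp at hp1
    simp [hφ] at hv
end

section
/- Let f : ℂⁿ → ℂ be a mixed polynomial such that f(Sing f) is a bounded subset of ℂ. Then there exists δ > 0 such that for every z ∈ ℂⁿ with |f(z)| ≥ δ, the vectors v₁(z) and v₂(z) are linearly independent over ℝ. -/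
open Complex Finset Filter Topology

theorem vOne_vTwo_indep {n : ℕ} (c : MixedCoeff n)
    (hb : Bornology.IsBounded (mixedEval c '' mixedSing c)) :
    ∃ δ > (0 : ℝ), ∀ z : Fin n → ℂ, δ ≤ ‖mixedEval c z‖ →
      LinearIndependent ℝ ![vOne c z, vTwo c z] := by
  obtain ⟨R, hR⟩ := hb.exists_norm_le
  refine ⟨max R 0 + 1, by positivity, fun z hz => ?_⟩
  have hpos : 0 < ‖mixedEval c z‖ := by
    have := le_max_right R 0
    linarith
  have hf : mixedEval c z ≠ 0 := norm_pos_iff.mp hpos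
  have hn : (‖mixedEval c z‖ : ℂ) ≠ 0 := by exact_mod_cast hpos.ne'
  rw [LinearIndependent.pair_iff]
  intro s t hst
  by_contra hne
  have hw : ((s : ℂ) + t * Complex.I) ≠ 0 := by
    intro h
    apply hne
    have h1 := congrArg Complex.re h
    have h2 := congrArg Complex.im h
    simp at h1 h2
    exact ⟨h1, h2⟩
  have hsing : z ∈ mixedSing c := by
    have hmu : ((s : ℂ) + t * Complex.I) * mixedEval c z ≠ 0 := mul_ne_zero hw hf
    refine ⟨-((starRingEnd ℂ) (((s : ℂ) + t * Complex.I) * mixedEval c z) /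
      (((s : ℂ) + t * Complex.I) * mixedEval c z)), ?_, fun j => ?_⟩
    · rw [norm_neg, norm_div, RCLike.norm_conj, div_self (norm_ne_zero_iff.mpr hmu)]
    · have hj := congrFun hst j
      simp only [Pi.add_apply, Pi.smul_apply, Pi.zero_apply, vOne, vTwo,
        Complex.real_smul] at hj
      have hj2 : ((s : ℂ) + t * Complex.I) * mixedEval c z * (starRingEnd ℂ) (wdz c j z)
          + ((s : ℂ) - t * Complex.I) * (starRingEnd ℂ) (mixedEval c z) * wdzbar c j z = 0 := by
        have h3 : ((‖mixedEval c z‖ : ℂ) ^ 2)⁻¹ ≠ 0 := inv_ne_zero (pow_ne_zero 2 hn)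
        apply (mul_eq_zero.mp (?_ : ((‖mixedEval c z‖ : ℂ) ^ 2)⁻¹ * _ = 0)).resolve_left h3
        linear_combination hj
      have hc : (starRingEnd ℂ) (((s : ℂ) + t * Complex.I) * mixedEval c z)
          = ((s : ℂ) - t * Complex.I) * (starRingEnd ℂ) (mixedEval c z) := by
        simp [sub_eq_add_neg]
      rw [hc]
      apply mul_left_cancel₀ hmu
      rw [← mul_assoc, mul_neg, mul_div_cancel₀ _ hmu]
      linear_combination hj2
  have := hR _ ⟨z, hsing, rfl⟩
  have := le_max_left R 0
  linarith
end

section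
/- Let f : ℂ² → ℂ be the mixed polynomial f(z₁,z₂) = (1/4)z₁² − (1/4)z̄₁² + z₁z̄₁ − (1+i)(z₁+z₂)(z̄₁+z̄₂). Then M(φ) is an unbounded subset of ℂ², and S(φ) = {−(1+i)/√2, (2+i)/√5, (2−i)/√5}. -/
open Complex Finset Filter Topology

theorem oka_conv {f g : ℝ → ℂ} {f' g' : ℂ} (h : HasDerivAt f f' 0) (e : ∀ t, g t = f t)
    (e' : g' = f') : HasDerivAt g g' 0 := by
  rw [e', funext e]; exact h

/-- partial derivative along a line in a single-variable product -/
theorem oka_term (a b z w : ℂ) (p q : ℕ) :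
    HasDerivAt (fun t : ℝ => a * (z + t * w) ^ p * (starRingEnd ℂ) (z + t * w) ^ q * b)
      ((a * p * z ^ (p - 1) * (starRingEnd ℂ) z ^ q * b) * w
        + (a * q * (starRingEnd ℂ) z ^ (q - 1) * z ^ p * b) * (starRingEnd ℂ) w) 0 := by
  have h0 : HasDerivAt (fun t : ℝ => (t : ℂ)) 1 0 := Complex.ofRealCLM.hasDerivAt
  have h1 : HasDerivAt (fun t : ℝ => z + t * w) w 0 := by
    simpa using (h0.mul_const w).const_add z
  have h2 : HasDerivAt (fun t : ℝ => (starRingEnd ℂ) (z + t * w)) ((starRingEnd ℂ) w) 0 := by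
    simpa using (h0.mul_const ((starRingEnd ℂ) w)).const_add ((starRingEnd ℂ) z)
  have h3 := (((h1.pow p).const_mul a).mul (h2.pow q)).mul_const b
  refine oka_conv h3 (fun t => ?_) ?_
  · simp
  · simp
    ring

theorem oka_d0 (c : MixedCoeff 2) (z : Fin 2 → ℂ) (w : ℂ) :
    HasDerivAt (fun t : ℝ => mixedEval c ![z 0 + t * w, z 1])
      (wdz c 0 z * w + wdzbar c 0 z * (starRingEnd ℂ) w) 0 := by
  have he : (Finset.univ.erase (0 : Fin 2)) = {1} := by decide
  unfold mixedEval wdz wdzbar Finsupp.sum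
  rw [Finset.sum_mul, Finset.sum_mul, ← Finset.sum_add_distrib]
  apply HasDerivAt.fun_sum
  intro p _
  refine oka_conv (oka_term (c p) (z 1 ^ p.1 1 * (starRingEnd ℂ) (z 1) ^ p.2 1) (z 0) w
    (p.1 0) (p.2 0)) (fun t => ?_) ?_
  · simp [Fin.prod_univ_two]; ring
  · simp [Fin.prod_univ_two, he]; ring

theorem oka_d1 (c : MixedCoeff 2) (z : Fin 2 → ℂ) (w : ℂ) :
    HasDerivAt (fun t : ℝ => mixedEval c ![z 0, z 1 + t * w])
      (wdz c 1 z * w + wdzbar c 1 z * (starRingEnd ℂ) w) 0 := by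
  have he : (Finset.univ.erase (1 : Fin 2)) = {0} := by decide
  unfold mixedEval wdz wdzbar Finsupp.sum
  rw [Finset.sum_mul, Finset.sum_mul, ← Finset.sum_add_distrib]
  apply HasDerivAt.fun_sum
  intro p _
  refine oka_conv (oka_term (c p) (z 0 ^ p.1 0 * (starRingEnd ℂ) (z 0) ^ p.2 0) (z 1) w
    (p.1 1) (p.2 1)) (fun t => ?_) ?_
  · simp [Fin.prod_univ_two]; ring
  · simp [Fin.prod_univ_two, he]; ring

theorem oka_sep {A B A' B' : ℂ}
    (h : ∀ w : ℂ, A * w + B * (starRingEnd ℂ) w = A' * w + B' * (starRingEnd ℂ) w) :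
    A = A' ∧ B = B' := by
  have h1 := h 1
  have h2 := h Complex.I
  simp only [map_one, mul_one, Complex.conj_I] at h1 h2
  have h3 : A - B = A' - B' := by
    have := Complex.I_ne_zero
    apply mul_right_cancel₀ this
    linear_combination h2
  constructor
  · linear_combination (h1 + h3) / 2
  · linear_combination (h1 - h3) / 2

/-- quadratic function of one real variable -/
theorem oka_quad (a b d : ℂ) :
    HasDerivAt (fun t : ℝ => a + (t : ℂ) * b + (t : ℂ) ^ 2 * d) b 0 := by
  have h0 : HasDerivAt (fun t : ℝ => (t : ℂ)) 1 0 := Complex.ofRealCLM.hasDerivAt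
  have h1 := ((h0.mul_const b).const_add a).add ((h0.mul h0).mul_const d)
  refine oka_conv h1 (fun t => ?_) ?_
  · simp only [Pi.add_apply, Pi.mul_apply]; ring
  · simp

/-- the function under study -/
noncomputable def okaF (z : Fin 2 → ℂ) : ℂ :=
  (1 / 4) * z 0 ^ 2 - (1 / 4) * (starRingEnd ℂ) (z 0) ^ 2
        + z 0 * (starRingEnd ℂ) (z 0)
        - (1 + Complex.I) * (z 0 + z 1) * ((starRingEnd ℂ) (z 0) + (starRingEnd ℂ) (z 1))

theorem oka_w0 (c : MixedCoeff 2) (hc : ∀ z, mixedEval c z = okaF z) (z : Fin 2 → ℂ) :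
    wdz c 0 z = z 0 / 2 + (starRingEnd ℂ) (z 0)
      - (1 + Complex.I) * ((starRingEnd ℂ) (z 0) + (starRingEnd ℂ) (z 1)) ∧
    wdzbar c 0 z = - (starRingEnd ℂ) (z 0) / 2 + z 0 - (1 + Complex.I) * (z 0 + z 1) := by
  apply oka_sep
  intro w
  refine (oka_d0 c z w).unique ?_
  refine oka_conv (oka_quad (okaF z) _ (w ^ 2 / 4 - (starRingEnd ℂ) w ^ 2 / 4
    - Complex.I * w * (starRingEnd ℂ) w)) (fun t => ?_) rfl
  rw [hc]
  simp [okaF]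
  ring

theorem oka_w1 (c : MixedCoeff 2) (hc : ∀ z, mixedEval c z = okaF z) (z : Fin 2 → ℂ) :
    wdz c 1 z = - (1 + Complex.I) * ((starRingEnd ℂ) (z 0) + (starRingEnd ℂ) (z 1)) ∧
    wdzbar c 1 z = - (1 + Complex.I) * (z 0 + z 1) := by
  apply oka_sep
  intro w
  refine (oka_d1 c z w).unique ?_
  refine oka_conv (oka_quad (okaF z) _ (- (1 + Complex.I) * w * (starRingEnd ℂ) w))
    (fun t => ?_) rfl
  rw [hc]
  simp [okaF]
  ring

theorem okaF_eq (z : Fin 2 → ℂ) : okaF z =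
    (((z 0).re ^ 2 + (z 0).im ^ 2 - (((z 0).re + (z 1).re) ^ 2 + ((z 0).im + (z 1).im) ^ 2) : ℝ) : ℂ)
    + (((z 0).re * (z 0).im - (((z 0).re + (z 1).re) ^ 2 + ((z 0).im + (z 1).im) ^ 2) : ℝ) : ℂ)
      * Complex.I := by
  apply Complex.ext <;> simp [okaF, pow_two] <;> ring

theorem oka_mem (c : MixedCoeff 2) (hc : ∀ z, mixedEval c z = okaF z) (z : Fin 2 → ℂ) :
    z ∈ Mphi c ↔ okaF z ≠ 0 ∧ ∃ l : ℝ,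
      l * (z 0).re = 2 * ((z 0).re + (z 1).re) * ((okaF z).re - (okaF z).im)
        + 2 * (okaF z).im * (z 0).re - (okaF z).re * (z 0).im ∧
      l * (z 0).im = 2 * ((z 0).im + (z 1).im) * ((okaF z).re - (okaF z).im)
        + 2 * (okaF z).im * (z 0).im - (okaF z).re * (z 0).re ∧
      l * (z 1).re = 2 * ((z 0).re + (z 1).re) * ((okaF z).re - (okaF z).im) ∧
      l * (z 1).im = 2 * ((z 0).im + (z 1).im) * ((okaF z).re - (okaF z).im) := by
  unfold Mphi
  simp only [Set.mem_ofPred_eq, hc, Fin.forall_fin_two]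
  rw [(oka_w0 c hc z).1, (oka_w0 c hc z).2, (oka_w1 c hc z).1, (oka_w1 c hc z).2]
  generalize okaF z = F
  refine and_congr Iff.rfl (exists_congr fun l => ?_)
  rw [Complex.ext_iff, Complex.ext_iff, and_assoc]
  have h2 : ∀ a : ℂ, a / 2 = ((1 / 2 : ℝ) : ℂ) * a := by intro a; push_cast; ring
  rw [h2, h2]
  simp only [Complex.mul_re, Complex.mul_im, Complex.add_re, Complex.add_im, Complex.sub_re,
    Complex.sub_im, Complex.neg_re, Complex.neg_im, Complex.conj_re, Complex.conj_im,
    Complex.I_re, Complex.I_im, Complex.ofReal_re, Complex.ofReal_im, Complex.one_re,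
    Complex.one_im, map_add, map_sub, map_mul, map_neg]
  ring_nf

theorem oka_vals (c : MixedCoeff 2) (hc : ∀ z, mixedEval c z = okaF z) (z : Fin 2 → ℂ)
    (hz : z ∈ Mphi c) : ∃ s : ℝ, 0 < s ∧
      (okaF z = s * (-(1 + Complex.I)) ∨ okaF z = s * (2 + Complex.I) ∨
        okaF z = s * (2 - Complex.I)) := by
  rw [oka_mem c hc] at hz
  obtain ⟨hF, l, h1, h2, h3, h4⟩ := hz
  have hu : (okaF z).re = (z 0).re ^ 2 + (z 0).im ^ 2
      - (((z 0).re + (z 1).re) ^ 2 + ((z 0).im + (z 1).im) ^ 2) := by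
    rw [okaF_eq, ← Complex.mk_eq_add_mul_I]
  have hv : (okaF z).im = (z 0).re * (z 0).im
      - (((z 0).re + (z 1).re) ^ 2 + ((z 0).im + (z 1).im) ^ 2) := by
    rw [okaF_eq, ← Complex.mk_eq_add_mul_I]
  have key : ∀ s : ℝ, okaF z = s * (-(1 + Complex.I)) ↔ (okaF z).re = -s ∧ (okaF z).im = -s := by
    intro s; rw [Complex.ext_iff]; simp
  have key2 : ∀ s : ℝ, okaF z = s * (2 + Complex.I) ↔ (okaF z).re = s * 2 ∧ (okaF z).im = s := by
    intro s; rw [Complex.ext_iff]; simp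
  have key3 : ∀ s : ℝ, okaF z = s * (2 - Complex.I) ↔ (okaF z).re = s * 2 ∧ (okaF z).im = -s := by
    intro s; rw [Complex.ext_iff]; simp
  simp only [key, key2, key3]
  have hF' : ¬ ((okaF z).re = 0 ∧ (okaF z).im = 0) := by
    intro h; exact hF (Complex.ext h.1 h.2)
  clear key key2 key3 hF
  generalize (okaF z).re = u at *
  generalize (okaF z).im = v at *
  generalize (z 0).re = x at *
  generalize (z 0).im = y at *
  obtain ⟨a, ha⟩ : ∃ a, a = x + (z 1).re := ⟨_, rfl⟩
  obtain ⟨b, hb⟩ : ∃ b, b = y + (z 1).im := ⟨_, rfl⟩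
  have ha' : (z 1).re = a - x := by linarith
  have hb' : (z 1).im = b - y := by linarith
  rw [ha'] at hu hv h1 h3
  rw [hb'] at hu hv h2 h4
  clear ha hb ha' hb'
  simp only [add_sub_cancel] at hu hv h1 h2 h3 h4
  have hl : l * (x ^ 2 + y ^ 2 + (a - x) ^ 2 + (b - y) ^ 2) = 0 := by
    have : l * (x ^ 2 + y ^ 2 + (a - x) ^ 2 + (b - y) ^ 2) =
      2 * (u - v) * (a ^ 2 + b ^ 2) + 2 * v * (x ^ 2 + y ^ 2) - 2 * u * (x * y) := by
      linear_combination x * h1 + y * h2 + (a - x) * h3 + (b - y) * h4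
    rw [this, hu, hv]; ring
  have hl0 : l = 0 := by
    rcases mul_eq_zero.1 hl with h | h
    · exact h
    · exfalso
      have hx : x = 0 := by nlinarith [sq_nonneg x, sq_nonneg y, sq_nonneg (a - x), sq_nonneg (b - y)]
      have hy : y = 0 := by nlinarith [sq_nonneg x, sq_nonneg y, sq_nonneg (a - x), sq_nonneg (b - y)]
      subst hx hy
      have ha : a = 0 := by nlinarith [sq_nonneg a, sq_nonneg b]
      have hb : b = 0 := by nlinarith [sq_nonneg a, sq_nonneg b]
      subst ha hb
      apply hF'; constructor <;> linarith
  subst hl0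
  by_cases huv : u = v
  · subst huv
    have hu0 : u ≠ 0 := fun h => hF' ⟨h, h⟩
    have e1 : 2 * x - y = 0 := by
      apply mul_left_cancel₀ hu0; linear_combination -h1
    have e2 : 2 * y - x = 0 := by
      apply mul_left_cancel₀ hu0; linear_combination -h2
    have hx : x = 0 := by linarith
    have hy : y = 0 := by linarith
    subst hx hy
    refine ⟨-u, ?_, Or.inl (by simp)⟩
    rcases lt_or_gt_of_ne hu0 with h | h
    · linarith
    · nlinarith [sq_nonneg a, sq_nonneg b]
  · have huv' : u - v ≠ 0 := sub_ne_zero.2 huv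
    have ha : a = 0 := by
      apply mul_right_cancel₀ huv'; linear_combination -h3 / 2
    have hb : b = 0 := by
      apply mul_right_cancel₀ huv'; linear_combination -h4 / 2
    subst ha hb
    have hu' : u = x ^ 2 + y ^ 2 := by linarith
    have hv' : v = x * y := by linarith
    subst hu' hv'
    have e1 : y * (x ^ 2 - y ^ 2) = 0 := by linear_combination -h1
    have e2 : x * (x ^ 2 - y ^ 2) = 0 := by linear_combination h2
    have e3 : (x - y) * (x + y) = 0 := by
      by_contra hne
      have hne' : x ^ 2 - y ^ 2 ≠ 0 := by
        intro h; apply hne; linear_combination h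
      have hx := (mul_eq_zero.1 e2).resolve_right hne'
      have hy := (mul_eq_zero.1 e1).resolve_right hne'
      apply hne; rw [hx, hy]; ring
    rcases mul_eq_zero.1 e3 with h | h
    · have : y = x := by linarith
      subst this
      have hy0 : y ≠ 0 := by rintro rfl; apply hF'; constructor <;> ring
      exact ⟨y ^ 2, by positivity, Or.inr (Or.inl ⟨by ring, by ring⟩)⟩
    · have : y = -x := by linarith
      subst this
      have hy0 : x ≠ 0 := by rintro rfl; apply hF'; constructor <;> ring
      exact ⟨x ^ 2, by positivity, Or.inr (Or.inr ⟨by ring, by ring⟩)⟩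

theorem oka_norm (a : ℂ) (r : ℝ) (h : Complex.normSq a = r) : ‖a‖ = Real.sqrt r := by
  rw [Complex.norm_def, h]

theorem oka_phi (c : MixedCoeff 2) (hc : ∀ z, mixedEval c z = okaF z) (z : Fin 2 → ℂ)
    (s : ℝ) (hs : 0 < s) (a : ℂ) (r : ℝ) (h : Complex.normSq a = r) (hz : okaF z = s * a) :
    phiMap c z = a / (Real.sqrt r : ℂ) := by
  unfold phiMap
  rw [hc, hz, norm_mul, oka_norm a r h, Complex.norm_real, Real.norm_of_nonneg hs.le,
    Complex.ofReal_mul, mul_div_mul_left]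
  exact_mod_cast hs.ne'

theorem oka_n1 : Complex.normSq (-(1 + Complex.I)) = 2 := by
  simp [Complex.normSq_apply]; norm_num
theorem oka_n2 : Complex.normSq (2 + Complex.I) = 5 := by
  simp [Complex.normSq_apply]; norm_num
theorem oka_n3 : Complex.normSq (2 - Complex.I) = 5 := by
  simp [Complex.normSq_apply]; norm_num

theorem oka_real (c : MixedCoeff 2) (hc : ∀ z, mixedEval c z = okaF z) (v a : ℂ) (r : ℝ)
    (h : Complex.normSq a = r) (ζ : ℕ → Fin 2 → ℂ) (hM : ∀ k, ζ k ∈ Mphi c)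
    (hn : ∀ k : ℕ, (k : ℝ) + 1 ≤ ‖ζ k 1‖)
    (hv : ∀ k, ∃ s : ℝ, 0 < s ∧ okaF (ζ k) = s * a) (hva : v = a / (Real.sqrt r : ℂ)) :
    v ∈ Sphi c := by
  refine ⟨ζ, hM, ?_, ?_⟩
  · refine tendsto_atTop_mono (fun k => ?_) tendsto_natCast_atTop_atTop
    have := norm_le_pi_norm (ζ k) 1
    have := hn k
    linarith
  · have : (fun k => phiMap c (ζ k)) = fun _ => v := by
      funext k
      obtain ⟨s, hs, e⟩ := hv k
      rw [oka_phi c hc _ s hs a r h e, hva]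
    rw [this]
    exact tendsto_const_nhds

theorem oka_unb (c : MixedCoeff 2) (v : ℂ) (hv : v ∈ Sphi c) :
    ¬ Bornology.IsBounded (Mphi c) := by
  obtain ⟨ζ, hM, ht, _⟩ := hv
  intro hb
  obtain ⟨C, hC⟩ := hb.exists_norm_le
  obtain ⟨k, hk⟩ := (ht.eventually (eventually_gt_atTop C)).exists
  exact absurd (hC _ (hM k)) (not_le.2 hk)

theorem oka_m1 (c : MixedCoeff 2) (hc : ∀ z, mixedEval c z = okaF z) :
    -(1 + Complex.I) / (Real.sqrt 2 : ℂ) ∈ Sphi c := by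
  have e : ∀ k : ℕ, okaF ![0, (k : ℂ) + 1] = ((((k : ℝ) + 1) ^ 2 : ℝ) : ℂ) * (-(1 + Complex.I)) := by
    intro k; simp [okaF]; ring
  refine oka_real c hc _ _ 2 oka_n1 (fun k => ![0, (k : ℂ) + 1]) ?_ ?_ ?_ rfl
  · intro k
    have hk : (k : ℝ) + 1 ≠ 0 := by positivity
    rw [oka_mem c hc, e k]
    refine ⟨?_, 0, ?_⟩
    · intro h0
      have := congrArg Complex.re h0
      simp [pow_two] at this
      norm_cast at this
    · simp [pow_two]
  · intro k
    have : ((k : ℂ) + 1) = (((k : ℝ) + 1 : ℝ) : ℂ) := by push_cast; rfl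
    simp only [Matrix.cons_val_one, Matrix.cons_val_fin_one]
    rw [this, Complex.norm_real]
    exact le_abs_self _
  · exact fun k => ⟨_, by positivity, e k⟩

theorem oka_m23 (c : MixedCoeff 2) (hc : ∀ z, mixedEval c z = okaF z) (δ : ℝ) (hδ : δ ^ 2 = 1) :
    (2 + δ * Complex.I) / (Real.sqrt 5 : ℂ) ∈ Sphi c := by
  have e : ∀ k : ℕ, okaF ![((k : ℝ) + 1 : ℝ) * (1 + δ * Complex.I), -(((k : ℝ) + 1 : ℝ) * (1 + δ * Complex.I))] = ((((k : ℝ) + 1) ^ 2 : ℝ) : ℂ) * (2 + δ * Complex.I) := by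
    intro k
    rw [okaF_eq]
    apply Complex.ext
    · simp [pow_two]; linear_combination ((k : ℝ) + 1) ^ 2 * hδ
    · simp [pow_two]; ring
  refine oka_real c hc _ (2 + δ * Complex.I) 5 ?_ (fun k => ![((k : ℝ) + 1 : ℝ) * (1 + δ * Complex.I), -(((k : ℝ) + 1 : ℝ) * (1 + δ * Complex.I))]) ?_ ?_ ?_ rfl
  · simp [Complex.normSq_apply]; linear_combination hδ
  · intro k
    have hk : (k : ℝ) + 1 ≠ 0 := by positivity
    rw [oka_mem c hc, e k]
    refine ⟨?_, 0, ?_, ?_, ?_, ?_⟩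
    · intro h0
      have := congrArg Complex.re h0
      simp [pow_two] at this
      norm_cast at this
    · simp [pow_two]; ring
    · simp [pow_two]
      linear_combination -2 * ((k : ℝ) + 1) ^ 3 * hδ
    · simp [pow_two]
    · simp [pow_two]
  · intro k
    have h := Complex.abs_re_le_norm (((k : ℝ) + 1 : ℝ) * (1 + δ * Complex.I))
    simp only [Matrix.cons_val_one, Matrix.cons_val_fin_one, norm_neg]
    refine le_trans ?_ h
    refine le_trans (le_of_eq ?_) (le_abs_self _)
    simp
  · exact fun k => ⟨_, by positivity, e k⟩

theorem oka_example_Sphi (c : MixedCoeff 2)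
    (hc : ∀ z : Fin 2 → ℂ, mixedEval c z =
      (1 / 4) * z 0 ^ 2 - (1 / 4) * (starRingEnd ℂ) (z 0) ^ 2
        + z 0 * (starRingEnd ℂ) (z 0)
        - (1 + Complex.I) * (z 0 + z 1) * ((starRingEnd ℂ) (z 0) + (starRingEnd ℂ) (z 1))) :
    ¬ Bornology.IsBounded (Mphi c) ∧
      Sphi c = {-(1 + Complex.I) / (Real.sqrt 2 : ℂ),
        (2 + Complex.I) / (Real.sqrt 5 : ℂ), (2 - Complex.I) / (Real.sqrt 5 : ℂ)} := by
  have hc' : ∀ z, mixedEval c z = okaF z := hc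
  have m2 : (2 + Complex.I) / (Real.sqrt 5 : ℂ) ∈ Sphi c := by
    simpa using oka_m23 c hc' 1 (by norm_num)
  have m3 : (2 - Complex.I) / (Real.sqrt 5 : ℂ) ∈ Sphi c := by
    simpa [sub_eq_add_neg] using oka_m23 c hc' (-1) (by norm_num)
  have m1 := oka_m1 c hc'
  refine ⟨oka_unb c _ m1, Set.Subset.antisymm ?_ ?_⟩
  · rintro v ⟨ζ, hM, _, ht⟩
    refine IsClosed.mem_of_tendsto (Set.Finite.isClosed (Set.toFinite _)) ht
      (Eventually.of_forall fun k => ?_)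
    obtain ⟨s, hs, h | h | h⟩ := oka_vals c hc' _ (hM k)
    · exact Or.inl (oka_phi c hc' _ s hs _ 2 oka_n1 h)
    · exact Or.inr (Or.inl (oka_phi c hc' _ s hs _ 5 oka_n2 h))
    · exact Or.inr (Or.inr (oka_phi c hc' _ s hs _ 5 oka_n3 h))
  · rintro v (rfl | rfl | rfl)
    · exact m1
    · exact m2
    · exact m3
end
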